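/- Let M be a complex manifold, S a closed subset, U_0 = M ∖ S, U_1 a neighborhood of S, and 𝒰 = {U_0, U_1}. (1) The map E^{p,q}_A(𝒰) → E^{p+1,q}(𝒰) given by (ξ_0, ξ_1, ξ_{01}^{(1)}, ξ_{01}^{(2)}) ↦ (∂ξ_0, ∂ξ_1, −∂ξ_{01}^{(1)}) induces a homomorphism ∂ : H^{p,q}_A(𝒰) → H^{p+1,q}_{∂̄ϑ}(𝒰), compatible with the homomorphism ∂ : H^{p,q}_A(M) → H^{p+1,q}_{∂̄}(M) induced by ∂ : E^{p,q}(M) → E^{p+1,q}(M), under the canonical isomorphisms H^{p,q}_A(M) ≅ H^{p,q}_A(𝒰) and H^{p+1,q}_{∂̄}(M) ≅ H^{p+1,q}_{∂̄ϑ}(𝒰). (2) The map E^{p,q}_A(𝒰, U_0) → E^{p+1,q}(𝒰, U_0) given by (ξ_1, ξ_{01}^{(1)}, ξ_{01}^{(2)}) ↦ (∂ξ_1, −∂ξ_{01}^{(1)}) induces a homomorphism ∂ : H^{p,q}_A(𝒰, U_0) → H^{p+1,q}_{∂̄ϑ}(𝒰, U_0). -/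

import Mathlib

/-!
Statement 9 (Proposition 3.14 of the paper).  Let `M` be a complex manifold, `S` a closed
subset, `U₀ = M ∖ S`, `U₁` a neighborhood of `S`, `𝒰 = {U₀, U₁}`.
(1) The map `E^{p,q}_A(𝒰) → E^{p+1,q}(𝒰)`,
`(ξ₀, ξ₁, ξ₀₁⁽¹⁾, ξ₀₁⁽²⁾) ↦ (∂ξ₀, ∂ξ₁, -∂ξ₀₁⁽¹⁾)` induces a homomorphism
`∂ : H^{p,q}_A(𝒰) → H^{p+1,q}_{∂̄ϑ}(𝒰)`, compatible with the homomorphism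
`∂ : H^{p,q}_A(M) → H^{p+1,q}_{∂̄}(M)` induced by `∂ : E^{p,q}(M) → E^{p+1,q}(M)`, under
the canonical isomorphisms `H^{p,q}_A(M) ≅ H^{p,q}_A(𝒰)` and
`H^{p+1,q}_{∂̄}(M) ≅ H^{p+1,q}_{∂̄ϑ}(𝒰)`.
(2) The map `E^{p,q}_A(𝒰,U₀) → E^{p+1,q}(𝒰,U₀)`,
`(ξ₁, ξ₀₁⁽¹⁾, ξ₀₁⁽²⁾) ↦ (∂ξ₁, -∂ξ₀₁⁽¹⁾)` induces a homomorphism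
`∂ : H^{p,q}_A(𝒰,U₀) → H^{p+1,q}_{∂̄ϑ}(𝒰,U₀)` on relative cohomologies.

The sheaves of forms are modelled abstractly by `DoubleFormSheaf`; the maps are
characterized on classes of cocycles, and `H^{p,q}_A(M)`, `H^{p+1,q}_{∂̄}(M)` are realized
as `HAopen F ⊤`, `HDopen F ⊤`, with canonical isomorphisms induced by `ω ↦ (ω, ω, 0, 0)`
resp. `ω ↦ (ω, ω, 0)`.
-/

open TopologicalSpace

universe u

section LinearHelpers

variable {A B C S : Type u} [AddCommGroup A] [Module ℂ A] [AddCommGroup B] [Module ℂ B]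
  [AddCommGroup C] [Module ℂ C] [AddCommGroup S] [Module ℂ S]

/-- a linear map into a triple product -/
def lmTri (f : S →ₗ[ℂ] A) (g : S →ₗ[ℂ] B) (h : S →ₗ[ℂ] C) : S →ₗ[ℂ] A × B × C :=
  LinearMap.prod f (LinearMap.prod g h)

/-- first projection of a triple product -/
def pA : A × B × C →ₗ[ℂ] A := LinearMap.fst ℂ A (B × C)

/-- second projection of a triple product -/
def pB : A × B × C →ₗ[ℂ] B := (LinearMap.fst ℂ B C).comp (LinearMap.snd ℂ A (B × C))

/-- third projection of a triple product -/
def pC : A × B × C →ₗ[ℂ] C := (LinearMap.snd ℂ B C).comp (LinearMap.snd ℂ A (B × C))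

/-- first projection of a pair -/
def qA : A × B →ₗ[ℂ] A := LinearMap.fst ℂ A B

/-- second projection of a pair -/
def qB : A × B →ₗ[ℂ] B := LinearMap.snd ℂ A B

end LinearHelpers

/-- The cohomology of a pair of composable linear maps `f : A → B`, `g : B → C` with
`g ∘ f = 0` (in the situations where this is used):  `Ker g / Im f`. -/
abbrev cohomOf {A B C : Type u} [AddCommGroup A] [Module ℂ A] [AddCommGroup B] [Module ℂ B]
    [AddCommGroup C] [Module ℂ C] (f : A →ₗ[ℂ] B) (g : B →ₗ[ℂ] C) : Type u :=
  ↥(LinearMap.ker g) ⧸ (Submodule.comap (LinearMap.ker g).subtype (LinearMap.range f))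

/-- The cohomology class of a cocycle. -/
def cohomMk {A B C : Type u} [AddCommGroup A] [Module ℂ A] [AddCommGroup B] [Module ℂ B]
    [AddCommGroup C] [Module ℂ C] (f : A →ₗ[ℂ] B) (g : B →ₗ[ℂ] C) (b : B) (hb : g b = 0) :
    cohomOf f g :=
  Submodule.Quotient.mk ⟨b, LinearMap.mem_ker.mpr hb⟩

/-- The sheaves `E^{p,q}` of `C^∞` differential forms of type `(p,q)` on (the underlying
topological space of) a complex manifold, encoded abstractly: a presheaf of `ℂ`-modules
`E p q U` with the differentials `∂` (`del`) and `∂̄` (`dbar`), satisfying `∂² = ∂̄² = 0`,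
`∂∂̄ + ∂̄∂ = 0`, compatibility with restrictions, the sheaf gluing condition for pairs of
open sets, and the softness property coming from `C^∞` partitions of unity (`pou`). -/
structure DoubleFormSheaf (X : Type u) [TopologicalSpace X] : Type (u + 1) where
  /-- the `ℂ`-module of `(p,q)`-forms on an open set `U` -/
  E : ℤ → ℤ → Opens X → ModuleCat.{u} ℂ
  /-- restriction of forms -/
  res : ∀ (p q : ℤ) ⦃U V : Opens X⦄, U ≤ V → ((E p q V) →ₗ[ℂ] (E p q U))
  res_refl : ∀ (p q : ℤ) (U : Opens X) (x : E p q U), res p q (le_refl U) x = x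
  res_res : ∀ (p q : ℤ) ⦃U V W : Opens X⦄ (hUV : U ≤ V) (hVW : V ≤ W) (x : E p q W),
      res p q hUV (res p q hVW x) = res p q (hUV.trans hVW) x
  /-- the differential `∂` -/
  del : ∀ (p q : ℤ) (U : Opens X), (E p q U) →ₗ[ℂ] (E (p + 1) q U)
  /-- the differential `∂̄` -/
  dbar : ∀ (p q : ℤ) (U : Opens X), (E p q U) →ₗ[ℂ] (E p (q + 1) U)
  del_del : ∀ (p q : ℤ) (U : Opens X) (x : E p q U), del (p + 1) q U (del p q U x) = 0
  dbar_dbar : ∀ (p q : ℤ) (U : Opens X) (x : E p q U), dbar p (q + 1) U (dbar p q U x) = 0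
  del_dbar : ∀ (p q : ℤ) (U : Opens X) (x : E p q U),
      del p (q + 1) U (dbar p q U x) + dbar (p + 1) q U (del p q U x) = 0
  res_del : ∀ (p q : ℤ) ⦃U V : Opens X⦄ (h : U ≤ V) (x : E p q V),
      del p q U (res p q h x) = res (p + 1) q h (del p q V x)
  res_dbar : ∀ (p q : ℤ) ⦃U V : Opens X⦄ (h : U ≤ V) (x : E p q V),
      dbar p q U (res p q h x) = res p (q + 1) h (dbar p q V x)
  /-- sheaf condition: forms agreeing on the overlap glue -/
  glue : ∀ (p q : ℤ) ⦃U V : Opens X⦄ (a : E p q U) (b : E p q V),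
      res p q inf_le_left a = res p q inf_le_right b →
      ∃! c : E p q (U ⊔ V), res p q le_sup_left c = a ∧ res p q le_sup_right c = b
  /-- softness coming from `C^∞` partitions of unity subordinate to a two-set open cover:
  "multiplication by `ρ₁` (resp. `ρ₀`) followed by extension by zero" operators. -/
  pou : ∀ ⦃U V : Opens X⦄, U ⊔ V = ⊤ →
      ∃ (z₀ : ∀ p q : ℤ, ((E p q (U ⊓ V)) →ₗ[ℂ] (E p q U)))
        (z₁ : ∀ p q : ℤ, ((E p q (U ⊓ V)) →ₗ[ℂ] (E p q V))),
        ∀ (p q : ℤ) (x : E p q (U ⊓ V)),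
          res p q inf_le_left (z₀ p q x) + res p q inf_le_right (z₁ p q x) = x

namespace DoubleFormSheaf

variable {X : Type u} [TopologicalSpace X] (F : DoubleFormSheaf X)

/-- identification of the modules of forms in equal bidegrees -/
def cast (U : Opens X) :
    ∀ {p q p' q' : ℤ}, p = p' → q = q' → ((F.E p q U) →ₗ[ℂ] (F.E p' q' U))
  | _, _, _, _, rfl, rfl => LinearMap.id

section Cech

variable (U₀ U₁ : Opens X)

/-- Čech–Bott–Chern cochains `E^{p,q}_{BC}(𝒰) = E^{p,q}(U₀) ⊕ E^{p,q}(U₁) ⊕ E^{p-1,q-1}(U₀₁)` -/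
abbrev TBC (p q : ℤ) : Type u :=
  ↥(F.E p q U₀) × ↥(F.E p q U₁) × ↥(F.E (p - 1) (q - 1) (U₀ ⊓ U₁))

/-- Čech–Aeppli cochains
`E^{p,q}_{A}(𝒰) = E^{p,q}(U₀) ⊕ E^{p,q}(U₁) ⊕ E^{(p-1,q-1)+1}(U₀₁)`,
`E^{(p-1,q-1)+1} = E^{p,q-1} ⊕ E^{p-1,q}` -/
abbrev TA (p q : ℤ) : Type u :=
  ↥(F.E p q U₀) × ↥(F.E p q U₁) ×
    (↥(F.E p (q - 1) (U₀ ⊓ U₁)) × ↥(F.E (p - 1) q (U₀ ⊓ U₁)))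

/-- Čech cochains of the third type
`E^{(p,q)+1}(𝒰) = E^{(p,q)+1}(U₀) ⊕ E^{(p,q)+1}(U₁) ⊕ E^{p,q}(U₀₁)`,
`E^{(p,q)+1} = E^{p+1,q} ⊕ E^{p,q+1}` -/
abbrev TT (p q : ℤ) : Type u :=
  (↥(F.E (p + 1) q U₀) × ↥(F.E p (q + 1) U₀)) ×
    (↥(F.E (p + 1) q U₁) × ↥(F.E p (q + 1) U₁)) × ↥(F.E p q (U₀ ⊓ U₁))

/-- Čech–Dolbeault cochains `E^{p,q}(𝒰) = E^{p,q}(U₀) ⊕ E^{p,q}(U₁) ⊕ E^{p,q-1}(U₀₁)` -/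
abbrev TD (p q : ℤ) : Type u :=
  ↥(F.E p q U₀) × ↥(F.E p q U₁) × ↥(F.E p (q - 1) (U₀ ⊓ U₁))

/-- relative Čech–Bott–Chern cochains `E^{p,q}_{BC}(𝒰, U₀) = E^{p,q}(U₁) ⊕ E^{p-1,q-1}(U₀₁)` -/
abbrev RBC (p q : ℤ) : Type u :=
  ↥(F.E p q U₁) × ↥(F.E (p - 1) (q - 1) (U₀ ⊓ U₁))

/-- relative Čech–Aeppli cochains `E^{p,q}_{A}(𝒰, U₀) = E^{p,q}(U₁) ⊕ E^{(p-1,q-1)+1}(U₀₁)` -/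
abbrev RA (p q : ℤ) : Type u :=
  ↥(F.E p q U₁) × (↥(F.E p (q - 1) (U₀ ⊓ U₁)) × ↥(F.E (p - 1) q (U₀ ⊓ U₁)))

/-- relative Čech cochains of the third type `E^{(p,q)+1}(𝒰, U₀) = E^{(p,q)+1}(U₁) ⊕ E^{p,q}(U₀₁)` -/
abbrev RT (p q : ℤ) : Type u :=
  (↥(F.E (p + 1) q U₁) × ↥(F.E p (q + 1) U₁)) × ↥(F.E p q (U₀ ⊓ U₁))

/-- relative Čech–Dolbeault cochains `E^{p,q}(𝒰, U₀) = E^{p,q}(U₁) ⊕ E^{p,q-1}(U₀₁)` -/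
abbrev RD (p q : ℤ) : Type u :=
  ↥(F.E p q U₁) × ↥(F.E p (q - 1) (U₀ ⊓ U₁))

/-- the Čech differential `E^{p,q}_{BC}(𝒰) → E^{(p,q)+1}(𝒰)`,
`σ ↦ ((∂σ₀, ∂̄σ₀), (∂σ₁, ∂̄σ₁), σ₁ - σ₀ - ∂̄∂σ₀₁)` (i.e. `σ ↦ (dσ₀, dσ₁, σ₁ - σ₀ - ∂̄∂σ₀₁)`) -/
def DtoTT (p q : ℤ) : TBC F U₀ U₁ p q →ₗ[ℂ] TT F U₀ U₁ p q :=
  lmTri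
    (LinearMap.prod ((F.del p q U₀).comp pA) ((F.dbar p q U₀).comp pA))
    (LinearMap.prod ((F.del p q U₁).comp pB) ((F.dbar p q U₁).comp pB))
    (((F.res p q inf_le_right).comp pB - (F.res p q inf_le_left).comp pA) -
      ((F.cast (U₀ ⊓ U₁) (show p - 1 + 1 = p by ring) (show q - 1 + 1 = q by ring)).comp
        ((F.dbar (p - 1 + 1) (q - 1) (U₀ ⊓ U₁)).comp
          ((F.del (p - 1) (q - 1) (U₀ ⊓ U₁)).comp pC))))

/-- the Čech differential `E^{(p,q)+1}(𝒰) → E^{p+1,q+1}_{A?}(𝒰)`; more precisely the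
differential `E^{(p,q)+1}(𝒰) → E^{p+1,q+1}(𝒰)`-component of the mixed complex, landing in
the Aeppli-type cochains `E^{p+1,q+1}_{A}(𝒰)`:
`((α₀,β₀), (α₁,β₁), γ) ↦ (∂̄α₀ + ∂β₀, ∂̄α₁ + ∂β₁, (α₁ - α₀ - ∂γ, β₁ - β₀ - ∂̄γ))` -/
def DtoTA (p q : ℤ) : TT F U₀ U₁ p q →ₗ[ℂ] TA F U₀ U₁ (p + 1) (q + 1) :=
  lmTri
    (((F.dbar (p + 1) q U₀).comp (qA.comp pA)) + ((F.del p (q + 1) U₀).comp (qB.comp pA)))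
    (((F.dbar (p + 1) q U₁).comp (qA.comp pB)) + ((F.del p (q + 1) U₁).comp (qB.comp pB)))
    (LinearMap.prod
      ((F.cast (U₀ ⊓ U₁) rfl (show q = q + 1 - 1 by ring)).comp
        (((F.res (p + 1) q inf_le_right).comp (qA.comp pB) -
            (F.res (p + 1) q inf_le_left).comp (qA.comp pA)) -
          ((F.del p q (U₀ ⊓ U₁)).comp pC)))
      ((F.cast (U₀ ⊓ U₁) (show p = p + 1 - 1 by ring) rfl).comp
        (((F.res p (q + 1) inf_le_right).comp (qB.comp pB) -
            (F.res p (q + 1) inf_le_left).comp (qB.comp pA)) -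
          ((F.dbar p q (U₀ ⊓ U₁)).comp pC))))

/-- the Čech differential `E^{p,q}_{A}(𝒰) → E^{p+1,q+1}_{BC}(𝒰)`:
`(ξ₀, ξ₁, (η₁, η₂)) ↦ (∂̄∂ξ₀, ∂̄∂ξ₁, ξ₁ - ξ₀ - ∂̄η₁ - ∂η₂)` -/
def DtoTBC (p q : ℤ) : TA F U₀ U₁ p q →ₗ[ℂ] TBC F U₀ U₁ (p + 1) (q + 1) :=
  lmTri
    ((F.dbar (p + 1) q U₀).comp ((F.del p q U₀).comp pA))
    ((F.dbar (p + 1) q U₁).comp ((F.del p q U₁).comp pB))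
    ((F.cast (U₀ ⊓ U₁) (show p = p + 1 - 1 by ring) (show q = q + 1 - 1 by ring)).comp
      ((((F.res p q inf_le_right).comp pB - (F.res p q inf_le_left).comp pA) -
          ((F.cast (U₀ ⊓ U₁) rfl (show q - 1 + 1 = q by ring)).comp
            ((F.dbar p (q - 1) (U₀ ⊓ U₁)).comp (qA.comp pC)))) -
        ((F.cast (U₀ ⊓ U₁) (show p - 1 + 1 = p by ring) rfl).comp
          ((F.del (p - 1) q (U₀ ⊓ U₁)).comp (qB.comp pC)))))

/-- the Čech–Dolbeault differential `∂̄ϑ σ = (∂̄σ₀, ∂̄σ₁, σ₁ - σ₀ - ∂̄σ₀₁)` -/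
def DD (p q : ℤ) : TD F U₀ U₁ p q →ₗ[ℂ] TD F U₀ U₁ p (q + 1) :=
  lmTri
    ((F.dbar p q U₀).comp pA)
    ((F.dbar p q U₁).comp pB)
    (((F.cast (U₀ ⊓ U₁) rfl (show q = q + 1 - 1 by ring)).comp
        ((F.res p q inf_le_right).comp pB - (F.res p q inf_le_left).comp pA)) -
      ((F.cast (U₀ ⊓ U₁) rfl (show q - 1 + 1 = q + 1 - 1 by ring)).comp
        ((F.dbar p (q - 1) (U₀ ⊓ U₁)).comp pC)))

/-- the relative Čech differential `E^{p,q}_{BC}(𝒰,U₀) → E^{(p,q)+1}(𝒰,U₀)` -/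
def RtoTT (p q : ℤ) : RBC F U₀ U₁ p q →ₗ[ℂ] RT F U₀ U₁ p q :=
  LinearMap.prod
    (LinearMap.prod ((F.del p q U₁).comp qA) ((F.dbar p q U₁).comp qA))
    (((F.res p q inf_le_right).comp qA) -
      ((F.cast (U₀ ⊓ U₁) (show p - 1 + 1 = p by ring) (show q - 1 + 1 = q by ring)).comp
        ((F.dbar (p - 1 + 1) (q - 1) (U₀ ⊓ U₁)).comp
          ((F.del (p - 1) (q - 1) (U₀ ⊓ U₁)).comp qB))))

/-- the relative Čech differential `E^{(p,q)+1}(𝒰,U₀) → E^{p+1,q+1}_{A}(𝒰,U₀)` -/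
def RtoTA (p q : ℤ) : RT F U₀ U₁ p q →ₗ[ℂ] RA F U₀ U₁ (p + 1) (q + 1) :=
  LinearMap.prod
    (((F.dbar (p + 1) q U₁).comp (qA.comp qA)) + ((F.del p (q + 1) U₁).comp (qB.comp qA)))
    (LinearMap.prod
      ((F.cast (U₀ ⊓ U₁) rfl (show q = q + 1 - 1 by ring)).comp
        (((F.res (p + 1) q inf_le_right).comp (qA.comp qA)) -
          ((F.del p q (U₀ ⊓ U₁)).comp qB)))
      ((F.cast (U₀ ⊓ U₁) (show p = p + 1 - 1 by ring) rfl).comp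
        (((F.res p (q + 1) inf_le_right).comp (qB.comp qA)) -
          ((F.dbar p q (U₀ ⊓ U₁)).comp qB))))

/-- the relative Čech differential `E^{p,q}_{A}(𝒰,U₀) → E^{p+1,q+1}_{BC}(𝒰,U₀)` -/
def RtoTBC (p q : ℤ) : RA F U₀ U₁ p q →ₗ[ℂ] RBC F U₀ U₁ (p + 1) (q + 1) :=
  LinearMap.prod
    ((F.dbar (p + 1) q U₁).comp ((F.del p q U₁).comp qA))
    ((F.cast (U₀ ⊓ U₁) (show p = p + 1 - 1 by ring) (show q = q + 1 - 1 by ring)).comp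
      ((((F.res p q inf_le_right).comp qA) -
          ((F.cast (U₀ ⊓ U₁) rfl (show q - 1 + 1 = q by ring)).comp
            ((F.dbar p (q - 1) (U₀ ⊓ U₁)).comp (qA.comp qB)))) -
        ((F.cast (U₀ ⊓ U₁) (show p - 1 + 1 = p by ring) rfl).comp
          ((F.del (p - 1) q (U₀ ⊓ U₁)).comp (qB.comp qB)))))

/-- the relative Čech–Dolbeault differential -/
def DrD (p q : ℤ) : RD F U₀ U₁ p q →ₗ[ℂ] RD F U₀ U₁ p (q + 1) :=
  LinearMap.prod
    ((F.dbar p q U₁).comp qA)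
    (((F.cast (U₀ ⊓ U₁) rfl (show q = q + 1 - 1 by ring)).comp
        ((F.res p q inf_le_right).comp qA)) -
      ((F.cast (U₀ ⊓ U₁) rfl (show q - 1 + 1 = q + 1 - 1 by ring)).comp
        ((F.dbar p (q - 1) (U₀ ⊓ U₁)).comp qB)))

/-- identification of Čech–Bott–Chern cochains in equal bidegrees -/
def castTBC {p q p' q' : ℤ} (hp : p = p') (hq : q = q') :
    TBC F U₀ U₁ p q →ₗ[ℂ] TBC F U₀ U₁ p' q' :=
  lmTri ((F.cast U₀ hp hq).comp pA) ((F.cast U₁ hp hq).comp pB)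
    ((F.cast _ (by rw [hp]) (by rw [hq])).comp pC)

/-- identification of Čech–Aeppli cochains in equal bidegrees -/
def castTA {p q p' q' : ℤ} (hp : p = p') (hq : q = q') :
    TA F U₀ U₁ p q →ₗ[ℂ] TA F U₀ U₁ p' q' :=
  lmTri ((F.cast U₀ hp hq).comp pA) ((F.cast U₁ hp hq).comp pB)
    (LinearMap.prod ((F.cast _ hp (by rw [hq])).comp (qA.comp pC))
      ((F.cast _ (by rw [hp]) hq).comp (qB.comp pC)))

/-- identification of Čech–Dolbeault cochains in equal bidegrees -/
def castTD {p q p' q' : ℤ} (hp : p = p') (hq : q = q') :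
    TD F U₀ U₁ p q →ₗ[ℂ] TD F U₀ U₁ p' q' :=
  lmTri ((F.cast U₀ hp hq).comp pA) ((F.cast U₁ hp hq).comp pB)
    ((F.cast _ hp (by rw [hq])).comp pC)

/-- identification of relative Čech–Bott–Chern cochains in equal bidegrees -/
def castRBC {p q p' q' : ℤ} (hp : p = p') (hq : q = q') :
    RBC F U₀ U₁ p q →ₗ[ℂ] RBC F U₀ U₁ p' q' :=
  LinearMap.prod ((F.cast U₁ hp hq).comp qA)
    ((F.cast _ (by rw [hp]) (by rw [hq])).comp qB)

/-- identification of relative Čech–Aeppli cochains in equal bidegrees -/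
def castRA {p q p' q' : ℤ} (hp : p = p') (hq : q = q') :
    RA F U₀ U₁ p q →ₗ[ℂ] RA F U₀ U₁ p' q' :=
  LinearMap.prod ((F.cast U₁ hp hq).comp qA)
    (LinearMap.prod ((F.cast _ hp (by rw [hq])).comp (qA.comp qB))
      ((F.cast _ (by rw [hp]) hq).comp (qB.comp qB)))

/-- identification of relative Čech–Dolbeault cochains in equal bidegrees -/
def castRD {p q p' q' : ℤ} (hp : p = p') (hq : q = q') :
    RD F U₀ U₁ p q →ₗ[ℂ] RD F U₀ U₁ p' q' :=
  LinearMap.prod ((F.cast U₁ hp hq).comp qA)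
    ((F.cast _ hp (by rw [hq])).comp qB)

/-- the Čech–Bott–Chern cohomology `H^{p,q}_{BC}(𝒰)` -/
abbrev HBCcech (p q : ℤ) : Type u :=
  cohomOf
    ((castTBC F U₀ U₁ (show p - 1 + 1 = p by ring) (show q - 1 + 1 = q by ring)).comp
      (DtoTBC F U₀ U₁ (p - 1) (q - 1)))
    (DtoTT F U₀ U₁ p q)

/-- the Čech–Aeppli cohomology `H^{p,q}_{A}(𝒰)` -/
abbrev HAcech (p q : ℤ) : Type u :=
  cohomOf
    ((castTA F U₀ U₁ (show p - 1 + 1 = p by ring) (show q - 1 + 1 = q by ring)).comp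
      (DtoTA F U₀ U₁ (p - 1) (q - 1)))
    (DtoTBC F U₀ U₁ p q)

/-- the Čech cohomology of the third type `H^{(p,q)+1}(𝒰)` -/
abbrev HTcech (p q : ℤ) : Type u :=
  cohomOf (DtoTT F U₀ U₁ p q) (DtoTA F U₀ U₁ p q)

/-- the Čech–Dolbeault cohomology `H^{p,q}_{∂̄ϑ}(𝒰)` -/
abbrev HDcech (p q : ℤ) : Type u :=
  cohomOf ((castTD F U₀ U₁ rfl (show q - 1 + 1 = q by ring)).comp (DD F U₀ U₁ p (q - 1)))
    (DD F U₀ U₁ p q)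

/-- the relative Bott–Chern cohomology `H^{p,q}_{BC}(𝒰, U₀)` -/
abbrev HBCrel (p q : ℤ) : Type u :=
  cohomOf
    ((castRBC F U₀ U₁ (show p - 1 + 1 = p by ring) (show q - 1 + 1 = q by ring)).comp
      (RtoTBC F U₀ U₁ (p - 1) (q - 1)))
    (RtoTT F U₀ U₁ p q)

/-- the relative Aeppli cohomology `H^{p,q}_{A}(𝒰, U₀)` -/
abbrev HArel (p q : ℤ) : Type u :=
  cohomOf
    ((castRA F U₀ U₁ (show p - 1 + 1 = p by ring) (show q - 1 + 1 = q by ring)).comp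
      (RtoTA F U₀ U₁ (p - 1) (q - 1)))
    (RtoTBC F U₀ U₁ p q)

/-- the relative cohomology of the third type `H^{(p,q)+1}(𝒰, U₀)` -/
abbrev HTrel (p q : ℤ) : Type u :=
  cohomOf (RtoTT F U₀ U₁ p q) (RtoTA F U₀ U₁ p q)

/-- the relative Dolbeault cohomology `H^{p,q}_{∂̄ϑ}(𝒰, U₀)` -/
abbrev HDrel (p q : ℤ) : Type u :=
  cohomOf ((castRD F U₀ U₁ rfl (show q - 1 + 1 = q by ring)).comp (DrD F U₀ U₁ p (q - 1)))
    (DrD F U₀ U₁ p q)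

end Cech

section OpenSet

variable (W : Opens X)

/-- the differential `∂̄ + ∂ : E^{(p-1,q-1)+1}(W) → E^{p,q}(W)`, `(η₁, η₂) ↦ ∂̄η₁ + ∂η₂` -/
def plusW (p q : ℤ) :
    (↥(F.E p (q - 1) W) × ↥(F.E (p - 1) q W)) →ₗ[ℂ] ↥(F.E p q W) :=
  ((F.cast W rfl (show q - 1 + 1 = q by ring)).comp ((F.dbar p (q - 1) W).comp qA)) +
    ((F.cast W (show p - 1 + 1 = p by ring) rfl).comp ((F.del (p - 1) q W).comp qB))

/-- the differential `∂̄∂ : E^{p,q}(W) → E^{p+1,q+1}(W)` -/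
def ddbarW (p q : ℤ) : ↥(F.E p q W) →ₗ[ℂ] ↥(F.E (p + 1) (q + 1) W) :=
  (F.dbar (p + 1) q W).comp (F.del p q W)

/-- the differential `d : E^{p,q}(W) → E^{(p,q)+1}(W)`, `ω ↦ (∂ω, ∂̄ω)` -/
def dfullW (p q : ℤ) :
    ↥(F.E p q W) →ₗ[ℂ] (↥(F.E (p + 1) q W) × ↥(F.E p (q + 1) W)) :=
  LinearMap.prod (F.del p q W) (F.dbar p q W)

/-- the differential `∂̄ + ∂ : E^{(p,q)+1}(W) → E^{p+1,q+1}(W)`, `(α, β) ↦ ∂̄α + ∂β` -/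
def plusTW (p q : ℤ) :
    (↥(F.E (p + 1) q W) × ↥(F.E p (q + 1) W)) →ₗ[ℂ] ↥(F.E (p + 1) (q + 1) W) :=
  ((F.dbar (p + 1) q W).comp qA) + ((F.del p (q + 1) W).comp qB)

/-- the Bott–Chern cohomology `H^{p,q}_{BC}(W)` of an open set `W` -/
abbrev HBCopen (p q : ℤ) : Type u :=
  cohomOf
    ((F.cast W (show p - 1 + 1 = p by ring) (show q - 1 + 1 = q by ring)).comp
      (ddbarW F W (p - 1) (q - 1)))
    (dfullW F W p q)

/-- the Aeppli cohomology `H^{p,q}_{A}(W)` of an open set `W` -/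
abbrev HAopen (p q : ℤ) : Type u :=
  cohomOf (plusW F W p q) (ddbarW F W p q)

/-- the cohomology of the third type `H^{(p,q)+1}(W)` of an open set `W` -/
abbrev HTopen (p q : ℤ) : Type u :=
  cohomOf (dfullW F W p q) (plusTW F W p q)

/-- the Dolbeault cohomology `H^{p,q}_{∂̄}(W)` of an open set `W` -/
abbrev HDopen (p q : ℤ) : Type u :=
  cohomOf ((F.cast W rfl (show q - 1 + 1 = q by ring)).comp (F.dbar p (q - 1) W))
    (F.dbar p q W)

end OpenSet

section Tilde

variable (U₀ U₁ : Opens X)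

/-- the map `ω ↦ (ω|_{U₀}, ω|_{U₁}, 0)` into Čech–Bott–Chern cochains -/
def tBC (p q : ℤ) : ↥(F.E p q ⊤) →ₗ[ℂ] TBC F U₀ U₁ p q :=
  lmTri (F.res p q le_top) (F.res p q le_top) 0

/-- the map `ω ↦ (ω|_{U₀}, ω|_{U₁}, 0, 0)` into Čech–Aeppli cochains -/
def tA (p q : ℤ) : ↥(F.E p q ⊤) →ₗ[ℂ] TA F U₀ U₁ p q :=
  lmTri (F.res p q le_top) (F.res p q le_top) 0

/-- the map `ω ↦ (ω|_{U₀}, ω|_{U₁}, 0)` into Čech–Dolbeault cochains -/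
def tD (p q : ℤ) : ↥(F.E p q ⊤) →ₗ[ℂ] TD F U₀ U₁ p q :=
  lmTri (F.res p q le_top) (F.res p q le_top) 0

end Tilde

end DoubleFormSheaf

open DoubleFormSheaf

section Cohomology

variable {A B C A' B' C' : Type u} [AddCommGroup A] [Module ℂ A] [AddCommGroup B] [Module ℂ B]
  [AddCommGroup C] [Module ℂ C] [AddCommGroup A'] [Module ℂ A'] [AddCommGroup B'] [Module ℂ B']
  [AddCommGroup C'] [Module ℂ C']
  {f : A →ₗ[ℂ] B} {g : B →ₗ[ℂ] C} {f' : A' →ₗ[ℂ] B'} {g' : B' →ₗ[ℂ] C'}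

/-- The map on cohomology induced by a linear map preserving cocycles and coboundaries. -/
noncomputable def cohomMap (φ : B →ₗ[ℂ] B') (hker : ∀ b, g b = 0 → g' (φ b) = 0)
    (hrange : ∀ b, b ∈ LinearMap.range f → φ b ∈ LinearMap.range f') :
    cohomOf f g →ₗ[ℂ] cohomOf f' g' :=
  Submodule.mapQ _ _
    (φ.restrict (p := LinearMap.ker g) (q := LinearMap.ker g') fun b hb => hker b hb)
    fun b hb => hrange b.1 hb

theorem cohomMap_mk (φ : B →ₗ[ℂ] B') (hker : ∀ b, g b = 0 → g' (φ b) = 0)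
    (hrange : ∀ b, b ∈ LinearMap.range f → φ b ∈ LinearMap.range f') (b : B) (hb : g b = 0) :
    cohomMap φ hker hrange (cohomMk f g b hb) = cohomMk f' g' (φ b) (hker b hb) :=
  rfl

theorem cohomMk_surjective (x : cohomOf f g) : ∃ b hb, cohomMk f g b hb = x := by
  obtain ⟨⟨b, hb⟩, rfl⟩ := Submodule.Quotient.mk_surjective _ x
  exact ⟨b, hb, rfl⟩

theorem cohomMk_eq_iff {b c : B} {hb : g b = 0} {hc : g c = 0} :
    cohomMk f g b hb = cohomMk f g c hc ↔ b - c ∈ LinearMap.range f :=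
  Submodule.Quotient.eq _

theorem cohomMk_eq_zero_iff {b : B} {hb : g b = 0} :
    cohomMk f g b hb = 0 ↔ b ∈ LinearMap.range f :=
  Submodule.Quotient.mk_eq_zero _

theorem cohomMap_bijective (φ : B →ₗ[ℂ] B') (hker : ∀ b, g b = 0 → g' (φ b) = 0)
    (hrange : ∀ b, b ∈ LinearMap.range f → φ b ∈ LinearMap.range f')
    (hinj : ∀ b, φ b ∈ LinearMap.range f' → b ∈ LinearMap.range f)
    (hsurj : ∀ b', g' b' = 0 → ∃ b, g b = 0 ∧ φ b - b' ∈ LinearMap.range f') :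
    Function.Bijective (cohomMap (f := f) (f' := f') φ hker hrange) := by
  constructor
  · rw [injective_iff_map_eq_zero]
    intro x hx
    obtain ⟨b, hb, rfl⟩ := cohomMk_surjective x
    rw [cohomMap_mk, cohomMk_eq_zero_iff] at hx
    exact cohomMk_eq_zero_iff.2 (hinj b hx)
  · intro y
    obtain ⟨b', hb', rfl⟩ := cohomMk_surjective y
    obtain ⟨b, hb, h⟩ := hsurj b' hb'
    exact ⟨cohomMk f g b hb, (cohomMap_mk φ hker hrange b hb).trans (cohomMk_eq_iff.2 h)⟩

end Cohomology

namespace DoubleFormSheaf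

variable {X : Type u} [TopologicalSpace X] (F : DoubleFormSheaf X)

section Cast

variable {U V : Opens X} {p q p' q' p'' q'' : ℤ}

theorem cast_refl (hp : p = p) (hq : q = q) (x : F.E p q U) : F.cast U hp hq x = x :=
  rfl

theorem cast_cast (hp : p = p') (hq : q = q') (hp' : p' = p'') (hq' : q' = q'')
    (x : F.E p q U) :
    F.cast U hp' hq' (F.cast U hp hq x) = F.cast U (hp.trans hp') (hq.trans hq') x := by
  subst hp hq hp' hq'
  rfl

theorem cast_eq_zero_iff (hp : p = p') (hq : q = q') (x : F.E p q U) :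
    F.cast U hp hq x = 0 ↔ x = 0 := by
  subst hp hq
  rfl

theorem del_cast (hp : p = p') (hq : q = q') (x : F.E p q U) :
    F.del p' q' U (F.cast U hp hq x) = F.cast U (by rw [hp]) hq (F.del p q U x) := by
  subst hp hq
  rfl

theorem dbar_cast (hp : p = p') (hq : q = q') (x : F.E p q U) :
    F.dbar p' q' U (F.cast U hp hq x) = F.cast U hp (by rw [hq]) (F.dbar p q U x) := by
  subst hp hq
  rfl

theorem res_cast (hp : p = p') (hq : q = q') (h : U ≤ V) (x : F.E p q V) :
    F.res p' q' h (F.cast V hp hq x) = F.cast U hp hq (F.res p q h x) := by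
  subst hp hq
  rfl

theorem del_dbar_eq_neg (x : F.E p q U) :
    F.del p (q + 1) U (F.dbar p q U x) = -F.dbar (p + 1) q U (F.del p q U x) :=
  eq_neg_of_add_eq_zero_left (F.del_dbar p q U x)

end Cast

section Gluing

variable {U₀ U₁ : Opens X} {p q : ℤ}

theorem ext_of_cover (h : U₀ ⊔ U₁ = ⊤) {x y : F.E p q ⊤}
    (h₀ : F.res p q (le_top : U₀ ≤ ⊤) x = F.res p q le_top y)
    (h₁ : F.res p q (le_top : U₁ ≤ ⊤) x = F.res p q le_top y) : x = y := by
  have hres : F.res p q (le_top : U₀ ⊔ U₁ ≤ ⊤) x = F.res p q le_top y :=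
    (F.glue p q (F.res p q (le_top : U₀ ≤ ⊤) x) (F.res p q (le_top : U₁ ≤ ⊤) x)
      (by simp only [F.res_res])).unique
      (by simp only [F.res_res, and_self]) (by simp only [F.res_res, h₀, h₁, and_self])
  have := congrArg (F.res p q h.ge) hres
  simpa only [F.res_res, F.res_refl] using this

theorem exists_glue_of_cover (h : U₀ ⊔ U₁ = ⊤) (a : F.E p q U₀) (b : F.E p q U₁)
    (hab : F.res p q (inf_le_left : U₀ ⊓ U₁ ≤ U₀) a = F.res p q inf_le_right b) :
    ∃ c : F.E p q ⊤, F.res p q le_top c = a ∧ F.res p q le_top c = b := by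
  obtain ⟨c, ⟨ha, hb⟩, -⟩ := F.glue p q a b hab
  refine ⟨F.res p q h.ge c, ?_, ?_⟩
  · rwa [F.res_res]
  · rwa [F.res_res]

theorem exists_split_of_cover (h : U₀ ⊔ U₁ = ⊤) (x : F.E p q (U₀ ⊓ U₁)) :
    ∃ (a : F.E p q U₀) (b : F.E p q U₁),
      F.res p q inf_le_left a + F.res p q inf_le_right b = x := by
  obtain ⟨z₀, z₁, hz⟩ := F.pou h
  exact ⟨z₀ p q x, z₁ p q x, hz p q x⟩

end Gluing

section Differentials

variable {U V : Opens X} (p q : ℤ)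

/-- The differential `∂̄ : E^{p,q-1}(U) → E^{p,q}(U)`. -/
def dbarTo (U : Opens X) : F.E p (q - 1) U →ₗ[ℂ] F.E p q U :=
  (F.cast U rfl (show q - 1 + 1 = q by ring)).comp (F.dbar p (q - 1) U)

/-- The differential `∂ : E^{p-1,q}(U) → E^{p,q}(U)`. -/
def delTo (U : Opens X) : F.E (p - 1) q U →ₗ[ℂ] F.E p q U :=
  (F.cast U (show p - 1 + 1 = p by ring) rfl).comp (F.del (p - 1) q U)

theorem plusW_apply (x : F.E p (q - 1) U × F.E (p - 1) q U) :
    plusW F U p q x = F.dbarTo p q U x.1 + F.delTo p q U x.2 :=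
  rfl

theorem res_dbarTo (h : U ≤ V) (x : F.E p (q - 1) V) :
    F.res p q h (F.dbarTo p q V x) = F.dbarTo p q U (F.res p (q - 1) h x) := by
  simp [dbarTo, res_cast, res_dbar]

theorem res_delTo (h : U ≤ V) (x : F.E (p - 1) q V) :
    F.res p q h (F.delTo p q V x) = F.delTo p q U (F.res (p - 1) q h x) := by
  simp [delTo, res_cast, res_del]

theorem del_delTo (x : F.E (p - 1) q U) : F.del p q U (F.delTo p q U x) = 0 := by
  simp [delTo, del_cast, del_del]

theorem dbar_dbarTo (x : F.E p (q - 1) U) : F.dbar p q U (F.dbarTo p q U x) = 0 := by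
  simp [dbarTo, dbar_cast, dbar_dbar]

theorem del_dbarTo (x : F.E p (q - 1) U) :
    F.del p q U (F.dbarTo p q U x) = -F.dbarTo (p + 1) q U (F.del p (q - 1) U x) := by
  simp [dbarTo, del_cast, del_dbar_eq_neg]

theorem dbarTo_delTo_add (x : F.E (p - 1) (q - 1) U) :
    F.dbarTo p q U (F.delTo p (q - 1) U x) + F.delTo p q U (F.dbarTo (p - 1) q U x) = 0 := by
  simp [dbarTo, delTo, del_cast, dbar_cast, cast_cast, del_dbar_eq_neg]

end Differentials

section Cocycles

variable {U₀ U₁ : Opens X} {p q : ℤ}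

theorem DtoTBC_eq_zero_iff (ξ : TA F U₀ U₁ p q) :
    DtoTBC F U₀ U₁ p q ξ = 0 ↔
      F.dbar (p + 1) q U₀ (F.del p q U₀ ξ.1) = 0 ∧
      F.dbar (p + 1) q U₁ (F.del p q U₁ ξ.2.1) = 0 ∧
      F.res p q inf_le_right ξ.2.1 - F.res p q inf_le_left ξ.1 =
        F.dbarTo p q (U₀ ⊓ U₁) ξ.2.2.1 + F.delTo p q (U₀ ⊓ U₁) ξ.2.2.2 := by
  rw [← sub_eq_zero (a := F.res p q inf_le_right ξ.2.1 - F.res p q inf_le_left ξ.1), ← sub_sub]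
  conv_rhs => rw [← F.cast_eq_zero_iff (show p = p + 1 - 1 by ring) (show q = q + 1 - 1 by ring)]
  exact Prod.mk_eq_zero.trans (and_congr_right fun _ => Prod.mk_eq_zero)

theorem RtoTBC_eq_zero_iff (ξ : RA F U₀ U₁ p q) :
    RtoTBC F U₀ U₁ p q ξ = 0 ↔
      F.dbar (p + 1) q U₁ (F.del p q U₁ ξ.1) = 0 ∧
      F.res p q inf_le_right ξ.1 =
        F.dbarTo p q (U₀ ⊓ U₁) ξ.2.1 + F.delTo p q (U₀ ⊓ U₁) ξ.2.2 := by
  rw [← sub_eq_zero (a := F.res p q inf_le_right ξ.1), ← sub_sub]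
  conv_rhs => rw [← F.cast_eq_zero_iff (show p = p + 1 - 1 by ring) (show q = q + 1 - 1 by ring)]
  exact Prod.mk_eq_zero

theorem DD_eq_zero_iff (σ : TD F U₀ U₁ p q) :
    DD F U₀ U₁ p q σ = 0 ↔
      F.dbar p q U₀ σ.1 = 0 ∧ F.dbar p q U₁ σ.2.1 = 0 ∧
      F.res p q inf_le_right σ.2.1 - F.res p q inf_le_left σ.1 =
        F.dbarTo p q (U₀ ⊓ U₁) σ.2.2 := by
  rw [← sub_eq_zero (a := F.res p q inf_le_right σ.2.1 - F.res p q inf_le_left σ.1)]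
  conv_rhs => rw [← F.cast_eq_zero_iff (show p = p from rfl) (show q = q + 1 - 1 by ring)]
  rw [map_sub, dbarTo, LinearMap.comp_apply, cast_cast]
  exact Prod.mk_eq_zero.trans (and_congr_right fun _ => Prod.mk_eq_zero)

theorem DrD_eq_zero_iff (σ : RD F U₀ U₁ p q) :
    DrD F U₀ U₁ p q σ = 0 ↔
      F.dbar p q U₁ σ.1 = 0 ∧
      F.res p q inf_le_right σ.1 = F.dbarTo p q (U₀ ⊓ U₁) σ.2 := by
  rw [← sub_eq_zero (a := F.res p q inf_le_right σ.1)]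
  conv_rhs => rw [← F.cast_eq_zero_iff (show p = p from rfl) (show q = q + 1 - 1 by ring)]
  rw [map_sub, dbarTo, LinearMap.comp_apply, cast_cast]
  exact Prod.mk_eq_zero

end Cocycles

section Coboundaries

variable {U₀ U₁ : Opens X} {p q : ℤ}

theorem mem_range_DtoTA_iff (ξ : TA F U₀ U₁ p q) :
    ξ ∈ LinearMap.range ((castTA F U₀ U₁ (show p - 1 + 1 = p by ring)
        (show q - 1 + 1 = q by ring)).comp (DtoTA F U₀ U₁ (p - 1) (q - 1))) ↔
      ∃ (α₀ : F.E p (q - 1) U₀) (β₀ : F.E (p - 1) q U₀) (α₁ : F.E p (q - 1) U₁)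
        (β₁ : F.E (p - 1) q U₁) (γ : F.E (p - 1) (q - 1) (U₀ ⊓ U₁)),
        ξ = (F.dbarTo p q U₀ α₀ + F.delTo p q U₀ β₀, F.dbarTo p q U₁ α₁ + F.delTo p q U₁ β₁,
          F.res p (q - 1) inf_le_right α₁ - F.res p (q - 1) inf_le_left α₀ -
            F.delTo p (q - 1) (U₀ ⊓ U₁) γ,
          F.res (p - 1) q inf_le_right β₁ - F.res (p - 1) q inf_le_left β₀ -
            F.dbarTo (p - 1) q (U₀ ⊓ U₁) γ) := by
  constructor
  · rintro ⟨⟨⟨α₀, β₀⟩, ⟨α₁, β₁⟩, γ⟩, rfl⟩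
    refine ⟨F.cast _ (by ring) rfl α₀, F.cast _ rfl (by ring) β₀, F.cast _ (by ring) rfl α₁,
      F.cast _ rfl (by ring) β₁, γ, ?_⟩
    simp [castTA, DtoTA, lmTri, pA, pB, pC, qA, qB, dbarTo, delTo, del_cast, dbar_cast, res_cast,
      cast_cast]
  · rintro ⟨α₀, β₀, α₁, β₁, γ, rfl⟩
    refine ⟨((F.cast _ (by ring) rfl α₀, F.cast _ rfl (by ring) β₀),
      (F.cast _ (by ring) rfl α₁, F.cast _ rfl (by ring) β₁), γ), ?_⟩
    simp [castTA, DtoTA, lmTri, pA, pB, pC, qA, qB, dbarTo, delTo, del_cast, dbar_cast, res_cast,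
      cast_cast, cast_refl]

theorem mem_range_RtoTA_iff (ξ : RA F U₀ U₁ p q) :
    ξ ∈ LinearMap.range ((castRA F U₀ U₁ (show p - 1 + 1 = p by ring)
        (show q - 1 + 1 = q by ring)).comp (RtoTA F U₀ U₁ (p - 1) (q - 1))) ↔
      ∃ (α₁ : F.E p (q - 1) U₁) (β₁ : F.E (p - 1) q U₁) (γ : F.E (p - 1) (q - 1) (U₀ ⊓ U₁)),
        ξ = (F.dbarTo p q U₁ α₁ + F.delTo p q U₁ β₁,
          F.res p (q - 1) inf_le_right α₁ - F.delTo p (q - 1) (U₀ ⊓ U₁) γ,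
          F.res (p - 1) q inf_le_right β₁ - F.dbarTo (p - 1) q (U₀ ⊓ U₁) γ) := by
  constructor
  · rintro ⟨⟨⟨α₁, β₁⟩, γ⟩, rfl⟩
    refine ⟨F.cast _ (by ring) rfl α₁, F.cast _ rfl (by ring) β₁, γ, ?_⟩
    simp [castRA, RtoTA, qA, qB, dbarTo, delTo, del_cast, dbar_cast, res_cast, cast_cast]
  · rintro ⟨α₁, β₁, γ, rfl⟩
    refine ⟨((F.cast _ (by ring) rfl α₁, F.cast _ rfl (by ring) β₁), γ), ?_⟩
    simp [castRA, RtoTA, qA, qB, dbarTo, delTo, del_cast, dbar_cast, res_cast, cast_cast,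
      cast_refl]

theorem mem_range_DD_iff (σ : TD F U₀ U₁ p q) :
    σ ∈ LinearMap.range ((castTD F U₀ U₁ rfl (show q - 1 + 1 = q by ring)).comp
        (DD F U₀ U₁ p (q - 1))) ↔
      ∃ (τ₀ : F.E p (q - 1) U₀) (τ₁ : F.E p (q - 1) U₁) (τ₀₁ : F.E p (q - 1 - 1) (U₀ ⊓ U₁)),
        σ = (F.dbarTo p q U₀ τ₀, F.dbarTo p q U₁ τ₁,
          F.res p (q - 1) inf_le_right τ₁ - F.res p (q - 1) inf_le_left τ₀ -
            F.dbarTo p (q - 1) (U₀ ⊓ U₁) τ₀₁) := by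
  have key (τ : TD F U₀ U₁ p (q - 1)) :
      (castTD F U₀ U₁ rfl (show q - 1 + 1 = q by ring)).comp (DD F U₀ U₁ p (q - 1)) τ =
        (F.dbarTo p q U₀ τ.1, F.dbarTo p q U₁ τ.2.1,
          F.res p (q - 1) inf_le_right τ.2.1 - F.res p (q - 1) inf_le_left τ.1 -
            F.dbarTo p (q - 1) (U₀ ⊓ U₁) τ.2.2) := by
    simp [castTD, DD, lmTri, pA, pB, pC, dbarTo, cast_cast, cast_refl]
  constructor
  · rintro ⟨τ, rfl⟩
    exact ⟨τ.1, τ.2.1, τ.2.2, key τ⟩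
  · rintro ⟨τ₀, τ₁, τ₀₁, rfl⟩
    exact ⟨(τ₀, τ₁, τ₀₁), key _⟩

theorem mem_range_DrD_iff (σ : RD F U₀ U₁ p q) :
    σ ∈ LinearMap.range ((castRD F U₀ U₁ rfl (show q - 1 + 1 = q by ring)).comp
        (DrD F U₀ U₁ p (q - 1))) ↔
      ∃ (τ₁ : F.E p (q - 1) U₁) (τ₀₁ : F.E p (q - 1 - 1) (U₀ ⊓ U₁)),
        σ = (F.dbarTo p q U₁ τ₁,
          F.res p (q - 1) inf_le_right τ₁ - F.dbarTo p (q - 1) (U₀ ⊓ U₁) τ₀₁) := by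
  have key (τ : RD F U₀ U₁ p (q - 1)) :
      (castRD F U₀ U₁ rfl (show q - 1 + 1 = q by ring)).comp (DrD F U₀ U₁ p (q - 1)) τ =
        (F.dbarTo p q U₁ τ.1,
          F.res p (q - 1) inf_le_right τ.1 - F.dbarTo p (q - 1) (U₀ ⊓ U₁) τ.2) := by
    simp [castRD, DrD, qA, qB, dbarTo, cast_cast, cast_refl]
  constructor
  · rintro ⟨τ, rfl⟩
    exact ⟨τ.1, τ.2, key τ⟩
  · rintro ⟨τ₁, τ₀₁, rfl⟩
    exact ⟨(τ₁, τ₀₁), key _⟩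

end Coboundaries

section DelMaps

variable (U₀ U₁ : Opens X) (p q : ℤ)

theorem del_plus {U : Opens X} {p q : ℤ} (α : F.E p (q - 1) U) (β : F.E (p - 1) q U) :
    F.del p q U (F.dbarTo p q U α + F.delTo p q U β) =
      F.dbarTo (p + 1) q U (-F.del p (q - 1) U α) := by
  simp [del_dbarTo, del_delTo]

theorem dbar_del_plus {U : Opens X} {p q : ℤ} (α : F.E p (q - 1) U) (β : F.E (p - 1) q U) :
    F.dbar (p + 1) q U (F.del p q U (F.dbarTo p q U α + F.delTo p q U β)) = 0 := by
  rw [del_plus, dbar_dbarTo]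

/-- The cochain map `(ξ₀, ξ₁, ξ₀₁⁽¹⁾, ξ₀₁⁽²⁾) ↦ (∂ξ₀, ∂ξ₁, -∂ξ₀₁⁽¹⁾)`. -/
def delTA : TA F U₀ U₁ p q →ₗ[ℂ] TD F U₀ U₁ (p + 1) q :=
  lmTri ((F.del p q U₀).comp pA) ((F.del p q U₁).comp pB)
    (-(F.del p (q - 1) (U₀ ⊓ U₁)).comp (qA.comp pC))

theorem delTA_apply (ξ : TA F U₀ U₁ p q) :
    delTA F U₀ U₁ p q ξ = (F.del p q U₀ ξ.1, F.del p q U₁ ξ.2.1,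
      -(F.del p (q - 1) (U₀ ⊓ U₁) ξ.2.2.1)) :=
  rfl

/-- The relative cochain map `(ξ₁, ξ₀₁⁽¹⁾, ξ₀₁⁽²⁾) ↦ (∂ξ₁, -∂ξ₀₁⁽¹⁾)`. -/
def delRA : RA F U₀ U₁ p q →ₗ[ℂ] RD F U₀ U₁ (p + 1) q :=
  LinearMap.prod ((F.del p q U₁).comp qA) (-(F.del p (q - 1) (U₀ ⊓ U₁)).comp (qA.comp qB))

theorem delRA_apply (ξ : RA F U₀ U₁ p q) :
    delRA F U₀ U₁ p q ξ = (F.del p q U₁ ξ.1, -(F.del p (q - 1) (U₀ ⊓ U₁) ξ.2.1)) :=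
  rfl

theorem DD_delTA (ξ : TA F U₀ U₁ p q) (hξ : DtoTBC F U₀ U₁ p q ξ = 0) :
    DD F U₀ U₁ (p + 1) q (delTA F U₀ U₁ p q ξ) = 0 := by
  obtain ⟨h₀, h₁, h₀₁⟩ := (F.DtoTBC_eq_zero_iff ξ).1 hξ
  refine (F.DD_eq_zero_iff _).2 ⟨h₀, h₁, ?_⟩
  simp only [delTA_apply]
  rw [← res_del, ← res_del, ← map_sub, h₀₁, del_plus]

theorem DrD_delRA (ξ : RA F U₀ U₁ p q) (hξ : RtoTBC F U₀ U₁ p q ξ = 0) :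
    DrD F U₀ U₁ (p + 1) q (delRA F U₀ U₁ p q ξ) = 0 := by
  obtain ⟨h₁, h₀₁⟩ := (F.RtoTBC_eq_zero_iff ξ).1 hξ
  refine (F.DrD_eq_zero_iff _).2 ⟨h₁, ?_⟩
  simp only [delRA_apply]
  rw [← res_del, h₀₁, del_plus]

theorem delTA_mem_range (ξ : TA F U₀ U₁ p q)
    (hξ : ξ ∈ LinearMap.range ((castTA F U₀ U₁ (show p - 1 + 1 = p by ring)
      (show q - 1 + 1 = q by ring)).comp (DtoTA F U₀ U₁ (p - 1) (q - 1)))) :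
    delTA F U₀ U₁ p q ξ ∈ LinearMap.range
      ((castTD F U₀ U₁ rfl (show q - 1 + 1 = q by ring)).comp (DD F U₀ U₁ (p + 1) (q - 1))) := by
  obtain ⟨α₀, β₀, α₁, β₁, γ, rfl⟩ := (F.mem_range_DtoTA_iff ξ).1 hξ
  refine (F.mem_range_DD_iff _).2
    ⟨-F.del p (q - 1) U₀ α₀, -F.del p (q - 1) U₁ α₁, 0, ?_⟩
  simp only [delTA_apply, del_plus]
  simp only [map_sub, map_neg, map_zero, del_delTo, res_del]
  congr 2
  abel

theorem delRA_mem_range (ξ : RA F U₀ U₁ p q)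
    (hξ : ξ ∈ LinearMap.range ((castRA F U₀ U₁ (show p - 1 + 1 = p by ring)
      (show q - 1 + 1 = q by ring)).comp (RtoTA F U₀ U₁ (p - 1) (q - 1)))) :
    delRA F U₀ U₁ p q ξ ∈ LinearMap.range
      ((castRD F U₀ U₁ rfl (show q - 1 + 1 = q by ring)).comp
        (DrD F U₀ U₁ (p + 1) (q - 1))) := by
  obtain ⟨α₁, β₁, γ, rfl⟩ := (F.mem_range_RtoTA_iff ξ).1 hξ
  refine (F.mem_range_DrD_iff _).2 ⟨-F.del p (q - 1) U₁ α₁, 0, ?_⟩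
  simp only [delRA_apply, del_plus]
  simp only [map_sub, map_neg, map_zero, del_delTo, res_del, sub_zero]

theorem del_mem_range {U : Opens X} (ω : F.E p q U)
    (hω : ω ∈ LinearMap.range (plusW F U p q)) :
    F.del p q U ω ∈ LinearMap.range
      ((F.cast U rfl (show q - 1 + 1 = q by ring)).comp (F.dbar (p + 1) (q - 1) U)) := by
  obtain ⟨η, rfl⟩ := hω
  exact ⟨-F.del p (q - 1) U η.1, (F.del_plus η.1 η.2).symm⟩

end DelMaps

section Canonical

variable {U₀ U₁ : Opens X} {p q : ℤ}

theorem tA_apply (ω : F.E p q ⊤) :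
    tA F U₀ U₁ p q ω = (F.res p q le_top ω, F.res p q le_top ω, 0, 0) :=
  rfl

theorem tD_apply (ω : F.E p q ⊤) :
    tD F U₀ U₁ p q ω = (F.res p q le_top ω, F.res p q le_top ω, 0) :=
  rfl

theorem DtoTBC_tA (ω : F.E p q ⊤) (hω : ddbarW F ⊤ p q ω = 0) :
    DtoTBC F U₀ U₁ p q (tA F U₀ U₁ p q ω) = 0 := by
  have hω' : F.dbar (p + 1) q ⊤ (F.del p q ⊤ ω) = 0 := hω
  refine (F.DtoTBC_eq_zero_iff _).2 ⟨?_, ?_, ?_⟩ <;>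
    simp [tA_apply, res_del, res_dbar, res_res, hω']

theorem DD_tD (ω : F.E p q ⊤) (hω : F.dbar p q ⊤ ω = 0) :
    DD F U₀ U₁ p q (tD F U₀ U₁ p q ω) = 0 := by
  refine (F.DD_eq_zero_iff _).2 ⟨?_, ?_, ?_⟩ <;> simp [tD_apply, res_dbar, res_res, hω]

theorem tA_mem_range (ω : F.E p q ⊤) (hω : ω ∈ LinearMap.range (plusW F ⊤ p q)) :
    tA F U₀ U₁ p q ω ∈ LinearMap.range ((castTA F U₀ U₁ (show p - 1 + 1 = p by ring)
      (show q - 1 + 1 = q by ring)).comp (DtoTA F U₀ U₁ (p - 1) (q - 1))) := by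
  obtain ⟨⟨α, β⟩, rfl⟩ := hω
  refine (F.mem_range_DtoTA_iff _).2 ⟨F.res _ _ le_top α, F.res _ _ le_top β,
    F.res _ _ le_top α, F.res _ _ le_top β, 0, ?_⟩
  simp [tA_apply, plusW_apply, res_dbarTo, res_delTo, res_res]

theorem tD_mem_range (ω : F.E p q ⊤) (hω : ω ∈ LinearMap.range (F.dbarTo p q ⊤)) :
    tD F U₀ U₁ p q ω ∈ LinearMap.range
      ((castTD F U₀ U₁ rfl (show q - 1 + 1 = q by ring)).comp (DD F U₀ U₁ p (q - 1))) := by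
  obtain ⟨τ, rfl⟩ := hω
  refine (F.mem_range_DD_iff _).2 ⟨F.res _ _ le_top τ, F.res _ _ le_top τ, 0, ?_⟩
  simp [tD_apply, res_dbarTo, res_res]

theorem mem_range_of_tA_mem_range (h : U₀ ⊔ U₁ = ⊤) (ω : F.E p q ⊤)
    (hω : tA F U₀ U₁ p q ω ∈ LinearMap.range ((castTA F U₀ U₁ (show p - 1 + 1 = p by ring)
      (show q - 1 + 1 = q by ring)).comp (DtoTA F U₀ U₁ (p - 1) (q - 1)))) :
    ω ∈ LinearMap.range (plusW F ⊤ p q) := by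
  obtain ⟨α₀, β₀, α₁, β₁, γ, hη⟩ := (F.mem_range_DtoTA_iff _).1 hω
  simp only [tA_apply, Prod.mk.injEq] at hη
  obtain ⟨h₀, h₁, hα, hβ⟩ := hη
  obtain ⟨c₀, c₁, rfl⟩ := F.exists_split_of_cover h γ
  obtain ⟨α, hα₀, hα₁⟩ := F.exists_glue_of_cover h
    (α₀ + F.delTo p (q - 1) U₀ c₀) (α₁ - F.delTo p (q - 1) U₁ c₁) (by
      simp only [map_add, map_sub, res_delTo] at hα ⊢
      rw [eq_sub_iff_add_eq, ← sub_eq_zero, ← neg_eq_zero, hα]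
      abel)
  obtain ⟨β, hβ₀, hβ₁⟩ := F.exists_glue_of_cover h
    (β₀ + F.dbarTo (p - 1) q U₀ c₀) (β₁ - F.dbarTo (p - 1) q U₁ c₁) (by
      simp only [map_add, map_sub, res_dbarTo] at hβ ⊢
      rw [eq_sub_iff_add_eq, ← sub_eq_zero, ← neg_eq_zero, hβ]
      abel)
  refine ⟨(α, β), F.ext_of_cover h ?_ ?_⟩
  · rw [h₀, plusW_apply, map_add, res_dbarTo, res_delTo, hα₀, hβ₀, map_add, map_add,
      add_add_add_comm, dbarTo_delTo_add, add_zero]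
  · rw [h₁, plusW_apply, map_add, res_dbarTo, res_delTo, hα₁, hβ₁, map_sub, map_sub,
      sub_add_sub_comm, dbarTo_delTo_add, sub_zero]

theorem mem_range_of_tD_mem_range (h : U₀ ⊔ U₁ = ⊤) (ω : F.E p q ⊤)
    (hω : tD F U₀ U₁ p q ω ∈ LinearMap.range
      ((castTD F U₀ U₁ rfl (show q - 1 + 1 = q by ring)).comp (DD F U₀ U₁ p (q - 1)))) :
    ω ∈ LinearMap.range (F.dbarTo p q ⊤) := by
  obtain ⟨τ₀, τ₁, τ₀₁, hτ⟩ := (F.mem_range_DD_iff _).1 hω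
  simp only [tD_apply, Prod.mk.injEq] at hτ
  obtain ⟨h₀, h₁, h₀₁⟩ := hτ
  obtain ⟨c₀, c₁, rfl⟩ := F.exists_split_of_cover h τ₀₁
  obtain ⟨τ, hτ₀, hτ₁⟩ := F.exists_glue_of_cover h
    (τ₀ + F.dbarTo p (q - 1) U₀ c₀) (τ₁ - F.dbarTo p (q - 1) U₁ c₁) (by
      simp only [map_add, map_sub, res_dbarTo] at h₀₁ ⊢
      rw [eq_sub_iff_add_eq, ← sub_eq_zero, ← neg_eq_zero, h₀₁]
      abel)
  have hsq {U : Opens X} (x : F.E p (q - 1 - 1) U) :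
      F.dbarTo p q U (F.dbarTo p (q - 1) U x) = 0 := by
    rw [dbarTo, LinearMap.comp_apply, dbar_dbarTo, map_zero]
  refine ⟨τ, F.ext_of_cover h ?_ ?_⟩
  · rw [h₀, res_dbarTo, hτ₀, map_add, hsq, add_zero]
  · rw [h₁, res_dbarTo, hτ₁, map_sub, hsq, sub_zero]

theorem exists_tA_sub_mem_range (h : U₀ ⊔ U₁ = ⊤) (ξ : TA F U₀ U₁ p q)
    (hξ : DtoTBC F U₀ U₁ p q ξ = 0) :
    ∃ ω : F.E p q ⊤, ddbarW F ⊤ p q ω = 0 ∧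
      tA F U₀ U₁ p q ω - ξ ∈ LinearMap.range ((castTA F U₀ U₁ (show p - 1 + 1 = p by ring)
        (show q - 1 + 1 = q by ring)).comp (DtoTA F U₀ U₁ (p - 1) (q - 1))) := by
  obtain ⟨ξ₀, ξ₁, α, β⟩ := ξ
  obtain ⟨h₀, h₁, h₀₁⟩ := (F.DtoTBC_eq_zero_iff _).1 hξ
  obtain ⟨α₀, α₁, rfl⟩ := F.exists_split_of_cover h α
  obtain ⟨β₀, β₁, rfl⟩ := F.exists_split_of_cover h β
  obtain ⟨ω, hω₀, hω₁⟩ := F.exists_glue_of_cover h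
    (ξ₀ + (F.dbarTo p q U₀ α₀ + F.delTo p q U₀ β₀))
    (ξ₁ - (F.dbarTo p q U₁ α₁ + F.delTo p q U₁ β₁)) (by
      simp only [map_add, map_sub, res_dbarTo, res_delTo] at h₀₁ ⊢
      rw [sub_eq_iff_eq_add] at h₀₁
      rw [h₀₁]
      abel)
  refine ⟨ω, F.ext_of_cover h ?_ ?_, (F.mem_range_DtoTA_iff _).2 ⟨α₀, β₀, -α₁, -β₁, 0, ?_⟩⟩
  · simp only [ddbarW, LinearMap.comp_apply]
    rw [← res_dbar, ← res_del, hω₀, map_add, map_add, dbar_del_plus, h₀, add_zero, map_zero]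
  · simp only [ddbarW, LinearMap.comp_apply]
    rw [← res_dbar, ← res_del, hω₁, map_sub, map_sub, dbar_del_plus, h₁, sub_zero, map_zero]
  · simp only [tA_apply, hω₀, hω₁, Prod.mk_sub_mk, map_neg, map_zero, Prod.mk.injEq]
    refine ⟨?_, ?_, ?_, ?_⟩ <;> abel

theorem exists_tD_sub_mem_range (h : U₀ ⊔ U₁ = ⊤) (σ : TD F U₀ U₁ p q)
    (hσ : DD F U₀ U₁ p q σ = 0) :
    ∃ ω : F.E p q ⊤, F.dbar p q ⊤ ω = 0 ∧
      tD F U₀ U₁ p q ω - σ ∈ LinearMap.range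
        ((castTD F U₀ U₁ rfl (show q - 1 + 1 = q by ring)).comp (DD F U₀ U₁ p (q - 1))) := by
  obtain ⟨σ₀, σ₁, τ⟩ := σ
  obtain ⟨h₀, h₁, h₀₁⟩ := (F.DD_eq_zero_iff _).1 hσ
  obtain ⟨τ₀, τ₁, rfl⟩ := F.exists_split_of_cover h τ
  obtain ⟨ω, hω₀, hω₁⟩ := F.exists_glue_of_cover h
    (σ₀ + F.dbarTo p q U₀ τ₀) (σ₁ - F.dbarTo p q U₁ τ₁) (by
      simp only [map_add, map_sub, res_dbarTo] at h₀₁ ⊢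
      rw [sub_eq_iff_eq_add] at h₀₁
      rw [h₀₁]
      abel)
  refine ⟨ω, F.ext_of_cover h ?_ ?_, (F.mem_range_DD_iff _).2 ⟨τ₀, -τ₁, 0, ?_⟩⟩
  · rw [← res_dbar, hω₀, map_add, dbar_dbarTo, h₀, add_zero, map_zero]
  · rw [← res_dbar, hω₁, map_sub, dbar_dbarTo, h₁, sub_zero, map_zero]
  · simp only [tD_apply, hω₀, hω₁, Prod.mk_sub_mk, map_neg, map_zero, Prod.mk.injEq]
    refine ⟨?_, ?_, ?_⟩ <;> abel

theorem delTA_tA (ω : F.E p q ⊤) :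
    delTA F U₀ U₁ p q (tA F U₀ U₁ p q ω) = tD F U₀ U₁ (p + 1) q (F.del p q ⊤ ω) := by
  simp [delTA_apply, tA_apply, tD_apply, res_del]

end Canonical

end DoubleFormSheaf

/-- Proposition 3.14 of the paper. -/
theorem statement9 {X : Type u} [TopologicalSpace X] (F : DoubleFormSheaf X)
    (S : Set X) (hS : IsClosed S) (U₁ : Opens X) (hU₁ : S ⊆ U₁) (p q : ℤ) :
    letI U₀ : Opens X := ⟨Sᶜ, hS.isOpen_compl⟩
    -- (1) the homomorphism `∂ : H^{p,q}_A(𝒰) → H^{p+1,q}_{∂̄ϑ}(𝒰)`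
    (∃ Φ : HAcech F U₀ U₁ p q →ₗ[ℂ] HDcech F U₀ U₁ (p + 1) q,
      -- it is induced by `(ξ₀, ξ₁, ξ₀₁⁽¹⁾, ξ₀₁⁽²⁾) ↦ (∂ξ₀, ∂ξ₁, -∂ξ₀₁⁽¹⁾)`
      (∀ (ξ : TA F U₀ U₁ p q) (hξ : DtoTBC F U₀ U₁ p q ξ = 0),
        ∃ h', Φ (cohomMk _ (DtoTBC F U₀ U₁ p q) ξ hξ)
          = cohomMk _ (DD F U₀ U₁ (p + 1) q)
              (F.del p q U₀ ξ.1, F.del p q U₁ ξ.2.1,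
                -(F.del p (q - 1) (U₀ ⊓ U₁) ξ.2.2.1)) h') ∧
      -- and it is compatible with `∂ : H^{p,q}_A(M) → H^{p+1,q}_{∂̄}(M)` via the canonical
      -- isomorphisms with the Čech cohomologies:
      ∃ (isoA : HAopen F (⊤ : Opens X) p q ≃ₗ[ℂ] HAcech F U₀ U₁ p q)
        (isoD : HDopen F (⊤ : Opens X) (p + 1) q ≃ₗ[ℂ] HDcech F U₀ U₁ (p + 1) q)
        (ΦM : HAopen F (⊤ : Opens X) p q →ₗ[ℂ] HDopen F (⊤ : Opens X) (p + 1) q),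
        (∀ (ω : ↥(F.E p q ⊤)) (hω : ddbarW F ⊤ p q ω = 0),
          ∃ h', isoA (cohomMk _ (ddbarW F ⊤ p q) ω hω)
            = cohomMk _ (DtoTBC F U₀ U₁ p q) (tA F U₀ U₁ p q ω) h') ∧
        (∀ (ω : ↥(F.E (p + 1) q ⊤)) (hω : F.dbar (p + 1) q ⊤ ω = 0),
          ∃ h', isoD (cohomMk _ (F.dbar (p + 1) q ⊤) ω hω)
            = cohomMk _ (DD F U₀ U₁ (p + 1) q) (tD F U₀ U₁ (p + 1) q ω) h') ∧
        (∀ (ω : ↥(F.E p q ⊤)) (hω : ddbarW F ⊤ p q ω = 0),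
          ∃ h', ΦM (cohomMk _ (ddbarW F ⊤ p q) ω hω)
            = cohomMk _ (F.dbar (p + 1) q ⊤) (F.del p q ⊤ ω) h') ∧
        (∀ x, Φ (isoA x) = isoD (ΦM x))) ∧
    -- (2) the relative homomorphism `∂ : H^{p,q}_A(𝒰,U₀) → H^{p+1,q}_{∂̄ϑ}(𝒰,U₀)`
    (∃ Φrel : HArel F U₀ U₁ p q →ₗ[ℂ] HDrel F U₀ U₁ (p + 1) q,
      ∀ (ξ : RA F U₀ U₁ p q) (hξ : RtoTBC F U₀ U₁ p q ξ = 0),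
        ∃ h', Φrel (cohomMk _ (RtoTBC F U₀ U₁ p q) ξ hξ)
          = cohomMk _ (DrD F U₀ U₁ (p + 1) q)
              (F.del p q U₁ ξ.1, -(F.del p (q - 1) (U₀ ⊓ U₁) ξ.2.1)) h') := by
  have hcover : (⟨Sᶜ, hS.isOpen_compl⟩ : Opens X) ⊔ U₁ = ⊤ := by
    ext x
    by_cases hx : x ∈ S
    · simpa [hx] using hU₁ hx
    · simp [hx]
  generalize (⟨Sᶜ, hS.isOpen_compl⟩ : Opens X) = U₀ at hcover ⊢
  refine ⟨⟨cohomMap (delTA F U₀ U₁ p q) (F.DD_delTA U₀ U₁ p q) (F.delTA_mem_range U₀ U₁ p q),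
      fun ξ hξ => ⟨F.DD_delTA U₀ U₁ p q ξ hξ, rfl⟩,
      LinearEquiv.ofBijective _ (cohomMap_bijective (tA F U₀ U₁ p q) F.DtoTBC_tA F.tA_mem_range
        (F.mem_range_of_tA_mem_range hcover) (F.exists_tA_sub_mem_range hcover)),
      LinearEquiv.ofBijective _ (cohomMap_bijective (tD F U₀ U₁ (p + 1) q) F.DD_tD
        F.tD_mem_range (F.mem_range_of_tD_mem_range hcover) (F.exists_tD_sub_mem_range hcover)),
      cohomMap (F.del p q ⊤) (fun _ hω => hω) (F.del_mem_range p q),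
      fun ω hω => ⟨F.DtoTBC_tA ω hω, rfl⟩, fun ω hω => ⟨F.DD_tD ω hω, rfl⟩,
      fun ω hω => ⟨hω, rfl⟩, fun x => ?_⟩,
    ⟨cohomMap (delRA F U₀ U₁ p q) (F.DrD_delRA U₀ U₁ p q) (F.delRA_mem_range U₀ U₁ p q),
      fun ξ hξ => ⟨F.DrD_delRA U₀ U₁ p q ξ hξ, rfl⟩⟩⟩
  obtain ⟨ω, hω, rfl⟩ := cohomMk_surjective x
  simp only [LinearEquiv.ofBijective_apply, cohomMap_mk, delTA_tA]
  rfl
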